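/- For every ε > 0 there exists a constant C > 0 such that for all primes p and all real T ≥ 1, Σ_{v=1}^{p−1} |R_{T,p}(v) − (6/π²)·T²/p| ≤ C·(T²·p^{−1} + T·p^{1/2+ε}). -/

import Mathlib

/-- `R_{T,p}(v)`: the number of pairs `(α, β)` of coprime integers with
`1 ≤ α, β ≤ T`, `gcd(β, p) = 1`, and `α ≡ v·β (mod p)`. -/
noncomputable def RTp (T : ℝ) (p : ℕ) (v : ℤ) : ℕ :=
  ((Finset.Icc 1 ⌊T⌋₊ ×ˢ Finset.Icc 1 ⌊T⌋₊).filter fun ab =>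
    Nat.Coprime ab.1 ab.2 ∧ Nat.Coprime ab.2 p ∧
      (ab.1 : ZMod p) = (v : ZMod p) * (ab.2 : ZMod p)).card

/-- The number of pairs `(a, b)` of integers in `[s, t]` with `a - v * b = r` in `ℤ/pℤ`. -/
noncomputable def boxCount (p : ℕ) (v : ZMod p) (s t : ℤ) (r : ZMod p) : ℕ :=
  ((Finset.Icc s t ×ˢ Finset.Icc s t).filter fun z : ℤ × ℤ =>
    (z.1 : ZMod p) - v * (z.2 : ZMod p) = r).card

lemma sum_boxCount (p : ℕ) [NeZero p] (v : ZMod p) (s t : ℤ) :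
    ∑ r : ZMod p, boxCount p v s t r = (t + 1 - s).toNat ^ 2 := by
  unfold boxCount
  rw [← Finset.card_eq_sum_card_fiberwise (fun _ _ => Finset.mem_coe.2 (Finset.mem_univ _))]
  simp [sq]

lemma boxCount_le_of_shift {p : ℕ} {v : ZMod p} {s t s' t' : ℤ} {r r' : ZMod p} {a b : ℤ}
    (hr : r + ((a : ZMod p) - v * b) = r') (ha : s' ≤ s + a) (ha' : t + a ≤ t')
    (hb : s' ≤ s + b) (hb' : t + b ≤ t') :
    boxCount p v s t r ≤ boxCount p v s' t' r' := by
  unfold boxCount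
  refine Finset.card_le_card_of_injOn (fun z => (z.1 + a, z.2 + b)) ?_ ?_
  · rintro ⟨x, y⟩ h
    simp only [Finset.coe_filter, Finset.mem_product, Finset.mem_Icc, Set.mem_ofPred_eq] at h ⊢
    refine ⟨⟨⟨by lia, by lia⟩, by lia, by lia⟩, ?_⟩
    rw [← hr, ← h.2]
    push_cast
    ring
  · rintro ⟨x, y⟩ _ ⟨x', y'⟩ _ h
    simp only [Prod.mk.injEq] at h ⊢
    lia

lemma abs_mul_boxCount_sub_sq_le {p : ℕ} [NeZero p] {v : ZMod p} {M : ℕ}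
    (hM : ∀ r : ZMod p, ∃ a b : ℤ, |a| ≤ M ∧ |b| ≤ M ∧ (a : ZMod p) - v * b = r) (n : ℕ) :
    |(p : ℝ) * boxCount p v 1 n 0 - n ^ 2| ≤ 4 * M * n + 4 * M ^ 2 := by
  have hcard : ∑ _r : ZMod p, boxCount p v 1 n 0 = p * boxCount p v 1 n 0 := by
    simp [ZMod.card]
  have upper : p * boxCount p v 1 n 0 ≤ (n + 2 * M) ^ 2 := by
    have h : p * boxCount p v 1 n 0 ≤ ∑ r : ZMod p, boxCount p v (1 - M) (n + M) r := by
      rw [← hcard]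
      refine Finset.sum_le_sum fun r _ => ?_
      obtain ⟨a, b, ha, hb, hr⟩ := hM r
      rw [abs_le] at ha hb
      exact boxCount_le_of_shift (a := a) (b := b) (by rw [hr, zero_add])
        (by lia) (by lia) (by lia) (by lia)
    rw [sum_boxCount] at h
    refine h.trans_eq ?_
    congr 1
    lia
  have lower : ((n : ℤ) - 2 * M).toNat ^ 2 ≤ p * boxCount p v 1 n 0 := by
    have h : ∑ r : ZMod p, boxCount p v (1 + M) (n - M) r ≤ p * boxCount p v 1 n 0 := by
      rw [← hcard]
      refine Finset.sum_le_sum fun r _ => ?_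
      obtain ⟨a, b, ha, hb, hr⟩ := hM (-r)
      rw [abs_le] at ha hb
      exact boxCount_le_of_shift (a := a) (b := b) (by rw [hr, add_neg_cancel])
        (by lia) (by lia) (by lia) (by lia)
    rw [sum_boxCount] at h
    refine Eq.trans_le ?_ h
    congr 1
    lia
  have upper' : (p : ℝ) * boxCount p v 1 n 0 ≤ (n + 2 * M) ^ 2 := by exact_mod_cast upper
  rw [abs_le]
  constructor
  · rcases le_total (2 * M) n with h | h
    · have h2 : ((n : ℤ) - 2 * M).toNat = n - 2 * M := by lia
      rw [h2] at lower
      have lower' : ((n : ℝ) - 2 * M) ^ 2 ≤ p * boxCount p v 1 n 0 := by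
        have : (((n - 2 * M : ℕ) : ℝ)) ^ 2 ≤ p * boxCount p v 1 n 0 := by exact_mod_cast lower
        rw [Nat.cast_sub h] at this
        push_cast at this
        exact this
      nlinarith [sq_nonneg (M : ℝ)]
    · have h' : (n : ℝ) ≤ 2 * M := by exact_mod_cast h
      have : (0 : ℝ) ≤ p * boxCount p v 1 n 0 := by positivity
      have : (0 : ℝ) ≤ n := by positivity
      nlinarith [sq_nonneg (M : ℝ)]
  · nlinarith

lemma exists_small_linear_combination {s t P r : ℤ} (hs : s ≠ 0) (hst : IsCoprime s t)
    (hts : |t| ≤ |s|) (hsP : s ^ 2 ≤ P) (hr : 0 ≤ r) (hrP : r < P) :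
    ∃ a b : ℤ, s * a + t * b = r ∧ |s| * |a| ≤ 2 * P ∧ |s| * |b| ≤ 2 * P := by
  obtain ⟨u, w, huw⟩ := hst
  have hs0 : 0 < |s| := abs_pos.2 hs
  have hb0 : 0 ≤ (w * r) % s := Int.emod_nonneg _ hs
  have hb1 : (w * r) % s < |s| := Int.emod_lt_abs _ hs
  have hdvd : s ∣ r - t * ((w * r) % s) := by
    refine ⟨u * r + t * (w * r / s), ?_⟩
    have := Int.emod_add_mul_ediv (w * r) s
    linear_combination (-r) * huw - t * this
  obtain ⟨a, ha⟩ := hdvd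
  have hss : |s| * |s| = s ^ 2 := by rw [← sq, sq_abs]
  refine ⟨a, (w * r) % s, by linarith, ?_, ?_⟩
  · rw [← abs_mul, ← ha]
    calc |r - t * ((w * r) % s)| ≤ |r| + |t * ((w * r) % s)| := abs_sub _ _
      _ = r + |t| * ((w * r) % s) := by rw [abs_mul, abs_of_nonneg hr, abs_of_nonneg hb0]
      _ ≤ P + |s| * |s| := by gcongr
      _ ≤ 2 * P := by lia
  · rw [abs_of_nonneg hb0]
    nlinarith

lemma exists_small_representative {p : ℕ} [Fact p.Prime] {v : ZMod p} {x y : ℤ} (hy : 0 < y)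
    (hyp : y ^ 2 ≤ p) (hxp : x ^ 2 ≤ p) (hxy : IsCoprime x y) (hv : (x : ZMod p) = v * y)
    (r : ZMod p) :
    ∃ a b : ℤ, max |x| y * |a| ≤ 2 * p ∧ max |x| y * |b| ≤ 2 * p ∧
      (a : ZMod p) - v * b = r := by
  have hp1 : 1 < p := (Fact.out : p.Prime).one_lt
  have hy0 : (y : ZMod p) ≠ 0 := by
    rw [Ne, ZMod.intCast_zmod_eq_zero_iff_dvd]
    intro h
    have := Int.le_of_dvd hy h
    have : (1 : ℤ) < p := by exact_mod_cast hp1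
    nlinarith
  set q : ZMod p := y * r with hq
  have hq0 : (0 : ℤ) ≤ q.val := by positivity
  have hqp : (q.val : ℤ) < p := by exact_mod_cast ZMod.val_lt q
  have key : ∀ a b : ℤ, y * a - x * b = q.val → (a : ZMod p) - v * b = r := by
    intro a b h
    have h' := congrArg (Int.cast : ℤ → ZMod p) h
    push_cast at h'
    rw [ZMod.natCast_zmod_val, hv] at h'
    refine mul_left_cancel₀ hy0 ?_
    rw [← hq, ← h']
    ring
  rcases le_total |x| y with h | h
  · obtain ⟨a, b, h1, h2, h3⟩ := exists_small_linear_combination (s := y) (t := -x) hy.ne'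
      hxy.symm.neg_right (by rwa [abs_neg, abs_of_pos hy]) hyp hq0 hqp
    rw [abs_of_pos hy] at h2 h3
    rw [max_eq_right h]
    exact ⟨a, b, h2, h3, key a b (by linarith)⟩
  · have hx : x ≠ 0 := by
      rintro rfl
      simp at h
      lia
    obtain ⟨b, a, h1, h2, h3⟩ := exists_small_linear_combination (s := -x) (t := y)
      (neg_ne_zero.2 hx) hxy.neg_left (by rwa [abs_neg, abs_of_pos hy]) (by rwa [neg_sq]) hq0 hqp
    rw [abs_neg] at h2 h3
    rw [max_eq_left h]
    exact ⟨a, b, h3, h2, key a b (by linarith)⟩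

lemma exists_short_coprime_vector (p : ℕ) [Fact p.Prime] (v : ZMod p) :
    ∃ x y : ℤ, 0 < y ∧ y ^ 2 ≤ p ∧ x ^ 2 ≤ p ∧ IsCoprime x y ∧ (x : ZMod p) = v * y := by
  have hp : 0 < p := (Fact.out : p.Prime).pos
  have hp1 : 1 < p := (Fact.out : p.Prime).one_lt
  obtain ⟨j, k, hk, hkn, hjk⟩ := Real.exists_int_int_abs_mul_sub_le ((v.val : ℝ) / p)
    (Nat.sqrt_pos.2 hp)
  set m := Nat.sqrt p
  have hm : m ^ 2 ≤ p := Nat.sqrt_le' p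
  have hm' : p < (m + 1) ^ 2 := Nat.lt_succ_sqrt' p
  set x : ℤ := k * v.val - j * p with hx
  have hk2 : k ^ 2 ≤ p := by
    have : ((m : ℤ)) ^ 2 ≤ p := by exact_mod_cast hm
    nlinarith
  have hx2 : x ^ 2 ≤ p := by
    have h1 : |(x : ℝ)| * (m + 1) ≤ p := by
      have hp' : (0 : ℝ) < p := by exact_mod_cast hp
      have : (x : ℝ) = p * (k * ((v.val : ℝ) / p) - j) := by
        rw [hx]; push_cast; field_simp
      rw [this, abs_mul, abs_of_pos hp']
      rw [le_div_iff₀ (by positivity)] at hjk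
      nlinarith
    have h2 : |x| * (m + 1) ≤ p := by exact_mod_cast h1
    have h3 : (p : ℤ) < (m + 1) ^ 2 := by exact_mod_cast hm'
    have h4 : |x| < m + 1 := by nlinarith
    rw [← sq_abs]
    nlinarith [abs_nonneg x]
  have hxv : (x : ZMod p) = v * k := by
    rw [hx]; push_cast; rw [ZMod.natCast_zmod_val, CharP.cast_eq_zero]; ring
  obtain ⟨g, hg⟩ : ∃ g : ℕ, g = Int.gcd x k := ⟨_, rfl⟩
  have hg0 : 0 < g := hg ▸ Int.gcd_pos_of_ne_zero_right x hk.ne'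
  have hgx : (g : ℤ) ∣ x := hg ▸ Int.gcd_dvd_left ..
  have hgk : (g : ℤ) ∣ k := hg ▸ Int.gcd_dvd_right ..
  obtain ⟨x', hx'⟩ := hgx
  obtain ⟨y', hy'⟩ := hgk
  have hg1 : (1 : ℤ) ≤ g := by exact_mod_cast hg0
  have hy'0 : 0 < y' := by
    by_contra! h
    nlinarith
  have hgp : (g : ZMod p) ≠ 0 := by
    rw [Ne, ZMod.natCast_eq_zero_iff]
    intro h
    have h1 : (p : ℤ) ≤ g := by exact_mod_cast Nat.le_of_dvd hg0 h
    have : (1 : ℤ) < p := by exact_mod_cast hp1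
    nlinarith
  have hg2 : (1 : ℤ) ≤ (g : ℤ) ^ 2 := by nlinarith
  refine ⟨x', y', hy'0, ?_, ?_, ?_, ?_⟩
  · have : k ^ 2 = (g : ℤ) ^ 2 * y' ^ 2 := by rw [hy']; ring
    nlinarith [sq_nonneg y']
  · have : x ^ 2 = (g : ℤ) ^ 2 * x' ^ 2 := by rw [hx']; ring
    nlinarith [sq_nonneg x']
  · rw [Int.isCoprime_iff_gcd_eq_one]
    have h : Int.gcd x k = g * Int.gcd x' y' := by
      rw [hx', hy', Int.gcd_mul_left, Int.natAbs_natCast]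
    rw [← hg] at h
    exact Nat.eq_of_mul_eq_mul_left hg0 (by rw [← h, mul_one])
  · refine mul_left_cancel₀ hgp ?_
    have h1 : (x : ZMod p) = g * x' := by rw [hx']; push_cast; ring
    have h2 : (k : ZMod p) = g * y' := by rw [hy']; push_cast; ring
    rw [← h1, hxv, h2]
    ring

lemma abs_boxCount_sub_le {p : ℕ} [Fact p.Prime] {v : ZMod p} {x y : ℤ} (hy : 0 < y)
    (hyp : y ^ 2 ≤ p) (hxp : x ^ 2 ≤ p) (hxy : IsCoprime x y) (hv : (x : ZMod p) = v * y)
    {n : ℕ} (hn : p ≤ n ^ 2) :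
    |(boxCount p v 1 n 0 : ℝ) - n ^ 2 / p| ≤
      24 * n * √p * ((max 1 (x.natAbs : ℝ))⁻¹ * (max 1 (y.natAbs : ℝ))⁻¹) := by
  have hp : (0 : ℝ) < p := by exact_mod_cast (Fact.out : p.Prime).pos
  obtain ⟨k, hk⟩ : ∃ k : ℕ, (k : ℤ) = max |x| y := ⟨(max |x| y).toNat, by lia⟩
  have hk0 : 0 < k := by lia
  have hkp : k ^ 2 ≤ p := by
    have : (k : ℤ) ^ 2 ≤ p := by
      rw [hk]
      rcases max_choice |x| y with h | h <;> rw [h]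
      · rwa [sq_abs]
      · exact hyp
    exact_mod_cast this
  have hbox := abs_mul_boxCount_sub_sq_le (p := p) (v := v) (M := 2 * p / k) (fun r => by
    obtain ⟨a, b, ha, hb, hr⟩ := exists_small_representative hy hyp hxp hxy hv r
    rw [← hk] at ha hb
    refine ⟨a, b, ?_, ?_, hr⟩
    · push_cast
      rw [Int.le_ediv_iff_mul_le (by lia)]
      linarith
    · push_cast
      rw [Int.le_ediv_iff_mul_le (by lia)]
      linarith) n
  set M := 2 * p / k
  have hkR : (0 : ℝ) < k := by exact_mod_cast hk0
  have hM : (M : ℝ) ≤ 2 * p / k := by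
    have := Nat.cast_div_le (α := ℝ) (m := 2 * p) (n := k)
    push_cast at this
    exact this
  have hs : √(p : ℝ) ^ 2 = p := Real.sq_sqrt hp.le
  have hks : (k : ℝ) ≤ √p := Real.le_sqrt_of_sq_le (by exact_mod_cast hkp)
  have hsn : √(p : ℝ) ≤ n := Real.sqrt_le_iff.2 ⟨by positivity, by exact_mod_cast hn⟩
  have hs0 : 0 < √(p : ℝ) := Real.sqrt_pos.2 hp
  have h1 : |(boxCount p v 1 n 0 : ℝ) - n ^ 2 / p| ≤ 24 * n * √p * ((k : ℝ) ^ 2)⁻¹ := by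
    have : (boxCount p v 1 n 0 : ℝ) - n ^ 2 / p = (p * boxCount p v 1 n 0 - n ^ 2) / p := by
      field_simp
    rw [this, abs_div, abs_of_pos hp, div_le_iff₀ hp]
    calc _ ≤ _ := hbox
      _ ≤ 4 * (2 * p / k) * n + 4 * (2 * p / k) ^ 2 := by gcongr
      _ = (8 * n * k + 16 * √(p : ℝ) * √(p : ℝ)) * ((k : ℝ) ^ 2)⁻¹ * p := by
        rw [mul_assoc 16, ← sq, hs]; field_simp; ring
      _ ≤ (8 * n * √p + 16 * n * √(p : ℝ)) * ((k : ℝ) ^ 2)⁻¹ * p := by gcongr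
      _ = _ := by ring
  refine h1.trans ?_
  gcongr
  rw [← mul_inv, sq]
  have h1k : (1 : ℝ) ≤ k := by exact_mod_cast hk0
  have hxk : (x.natAbs : ℝ) ≤ k := by
    have : x.natAbs ≤ k := by zify; rw [hk]; exact le_max_left _ _
    exact_mod_cast this
  have hyk : (y.natAbs : ℝ) ≤ k := by
    have : y.natAbs ≤ k := by lia
    exact_mod_cast this
  gcongr
  · exact max_le h1k hxk
  · exact max_le h1k hyk

lemma sum_range_inv_max_one_le (p : ℕ) :
    ∑ k ∈ Finset.range (p + 1), (max 1 (k : ℝ))⁻¹ ≤ 2 + Real.log p := by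
  have h := harmonic_le_one_add_log p
  rw [Finset.sum_range_succ']
  have : ∑ k ∈ Finset.range p, (max 1 ((k + 1 : ℕ) : ℝ))⁻¹ = harmonic p := by
    rw [harmonic]
    push_cast
    refine Finset.sum_congr rfl fun k _ => ?_
    rw [max_eq_right (by linarith [k.cast_nonneg (α := ℝ)])]
  rw [this]
  simp only [Nat.cast_zero, zero_le_one, sup_of_le_left, inv_one]
  linarith

lemma sum_abs_boxCount_sub_le_of_le_sq {p n : ℕ} [Fact p.Prime] (hn : p ≤ n ^ 2) :
    ∑ v : ZMod p, |(boxCount p v 1 n 0 : ℝ) - n ^ 2 / p| ≤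
      48 * n * √p * (2 + Real.log p) ^ 2 := by
  choose X Y hY hYp hXp hXY hv using exists_short_coprime_vector p
  set w : ℕ → ℝ := fun k => (max 1 (k : ℝ))⁻¹ with hw
  have hw0 : ∀ k, 0 ≤ w k := fun k => by positivity
  let φ : ZMod p → Bool × ℕ × ℕ := fun v => (decide (0 ≤ X v), (X v).natAbs, (Y v).natAbs)
  have hφ : Function.Injective φ := by
    intro v v' h
    simp only [φ, Prod.mk.injEq, decide_eq_decide] at h
    have hXe : X v = X v' := by lia
    have hYe : Y v = Y v' := by have := hY v; have := hY v'; lia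
    have hy0 : (Y v : ZMod p) ≠ 0 := by
      rw [Ne, ZMod.intCast_zmod_eq_zero_iff_dvd]
      intro h
      have h1 := Int.le_of_dvd (hY v) h
      have h2 : (1 : ℤ) < p := by exact_mod_cast (Fact.out : p.Prime).one_lt
      have h3 := hYp v
      nlinarith
    refine mul_right_cancel₀ hy0 ?_
    rw [← hv v, hXe, hv v', hYe]
  have natAbs_lt : ∀ z : ℤ, z ^ 2 ≤ p → z.natAbs ∈ Finset.range (p + 1) := by
    intro z hz
    rw [Finset.mem_range]
    have : z.natAbs ^ 2 ≤ p := by zify; rwa [sq_abs]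
    nlinarith
  calc _ ≤ ∑ v : ZMod p, 24 * n * √p * (w (X v).natAbs * w (Y v).natAbs) :=
        Finset.sum_le_sum fun v _ =>
          abs_boxCount_sub_le (hY v) (hYp v) (hXp v) (hXY v) (hv v) hn
    _ = 24 * n * √p * ∑ v : ZMod p, w (φ v).2.1 * w (φ v).2.2 := by rw [Finset.mul_sum]
    _ = 24 * n * √p * ∑ u ∈ Finset.univ.image φ, w u.2.1 * w u.2.2 := by
        rw [Finset.sum_image hφ.injOn]
    _ ≤ 24 * n * √p * ∑ u ∈ (Finset.univ : Finset Bool) ×ˢ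
          (Finset.range (p + 1) ×ˢ Finset.range (p + 1)), w u.2.1 * w u.2.2 := by
        refine mul_le_mul_of_nonneg_left (Finset.sum_le_sum_of_subset_of_nonneg ?_
          fun u _ _ => mul_nonneg (hw0 _) (hw0 _)) (by positivity)
        intro u hu
        obtain ⟨v, -, rfl⟩ := Finset.mem_image.1 hu
        exact Finset.mem_product.2 ⟨Finset.mem_univ _, Finset.mem_product.2
          ⟨natAbs_lt _ (hXp v), natAbs_lt _ (hYp v)⟩⟩
    _ = 48 * n * √p * (∑ k ∈ Finset.range (p + 1), w k) ^ 2 := by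
        rw [Finset.sum_product]
        simp only [Finset.sum_product, ← Finset.mul_sum, ← Finset.sum_mul, Finset.sum_const,
          Finset.card_univ, Fintype.card_bool, nsmul_eq_mul]
        push_cast
        ring
    _ ≤ _ := by
        gcongr
        exact sum_range_inv_max_one_le p

lemma sum_boxCount_zero_le_of_lt {p n : ℕ} [Fact p.Prime] (hn : n < p) :
    ∑ v : ZMod p, boxCount p v 1 n 0 ≤ n ^ 2 := by
  set I := Finset.Icc (1 : ℤ) n
  have h : (I ×ˢ I).card = n ^ 2 := by simp [I, sq]
  rw [← h, Finset.card_eq_sum_card_fiberwise (t := Finset.univ)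
    (f := fun z : ℤ × ℤ => (z.1 : ZMod p) / (z.2 : ZMod p))
    (fun _ _ => Finset.mem_coe.2 (Finset.mem_univ _))]
  refine Finset.sum_le_sum fun v _ => Finset.card_le_card ?_
  intro z hz
  rw [Finset.mem_filter] at hz ⊢
  refine ⟨hz.1, ?_⟩
  have hb := Finset.mem_Icc.1 (Finset.mem_product.1 hz.1).2
  have hb0 : (z.2 : ZMod p) ≠ 0 := by
    rw [Ne, ZMod.intCast_zmod_eq_zero_iff_dvd]
    intro h
    have := Int.le_of_dvd (by lia) h
    lia
  rw [div_eq_iff hb0, sub_eq_zero.1 hz.2]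

lemma sum_abs_boxCount_sub_le (p n : ℕ) [Fact p.Prime] :
    ∑ v : ZMod p, |(boxCount p v 1 n 0 : ℝ) - n ^ 2 / p| ≤
      48 * n * √p * (2 + Real.log p) ^ 2 := by
  rcases le_or_gt p (n ^ 2) with hn | hn
  · exact sum_abs_boxCount_sub_le_of_le_sq hn
  have hp : (0 : ℝ) < p := by exact_mod_cast (Fact.out : p.Prime).pos
  have hlog : 0 ≤ Real.log p := Real.log_natCast_nonneg p
  have hns : (n : ℝ) ≤ √p := Real.le_sqrt_of_sq_le (by exact_mod_cast hn.le)
  have hnp : n < p := by nlinarith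
  have hsum : ∑ v : ZMod p, (boxCount p v 1 n 0 : ℝ) ≤ n ^ 2 := by
    exact_mod_cast sum_boxCount_zero_le_of_lt hnp
  calc _ ≤ ∑ v : ZMod p, ((boxCount p v 1 n 0 : ℝ) + n ^ 2 / p) := by
        refine Finset.sum_le_sum fun v _ => (abs_sub _ _).trans_eq ?_
        rw [abs_of_nonneg (by positivity), abs_of_nonneg (by positivity)]
    _ = ∑ v : ZMod p, (boxCount p v 1 n 0 : ℝ) + n ^ 2 := by
        rw [Finset.sum_add_distrib, Finset.sum_const, Finset.card_univ, ZMod.card, nsmul_eq_mul,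
          mul_div_cancel₀ _ hp.ne']
    _ ≤ 2 * (n * n) := by linarith
    _ ≤ 2 * (n * √p) := by gcongr
    _ = 2 * n * √p * 1 := by ring
    _ ≤ 48 * n * √p * (2 + Real.log p) ^ 2 := by
        gcongr
        · norm_num
        · nlinarith

lemma hasSum_moebius_div_sq :
    HasSum (fun d : ℕ => (ArithmeticFunction.moebius d : ℝ) / (d : ℝ) ^ 2)
      (6 / Real.pi ^ 2) := by
  have h2 : 1 < (2 : ℂ).re := by norm_num
  have hz := ArithmeticFunction.LSeries_zeta_mul_Lseries_moebius h2
  rw [ArithmeticFunction.LSeries_zeta_eq_riemannZeta h2, riemannZeta_two] at hz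
  have hpi : (Real.pi : ℂ) ≠ 0 := by exact_mod_cast Real.pi_ne_zero
  have hs := (ArithmeticFunction.LSeriesSummable_moebius_iff.2 h2).LSeriesHasSum
  rw [LSeriesHasSum, eq_div_of_mul_eq (div_ne_zero (pow_ne_zero 2 hpi) (by norm_num))
    ((mul_comm _ _).trans hz)] at hs
  rw [← Complex.hasSum_ofReal]
  convert! hs using 1
  · ext d
    rcases eq_or_ne d 0 with rfl | hd
    · simp
    · rw [LSeries.term_of_ne_zero hd]
      push_cast
      norm_cast
  · push_cast
    rw [one_div_div]

lemma sum_Ioc_inv_sq_le_two (n : ℕ) : ∑ d ∈ Finset.Ioc 0 n, ((d : ℝ) ^ 2)⁻¹ ≤ 2 := by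
  have h := sum_Ioo_inv_sq_le (α := ℝ) 0 (n + 1)
  simpa [← Finset.Ioo_add_one_right_eq_Ioc] using h

lemma abs_sum_moebius_div_sq_sub_le {n : ℕ} (hn : n ≠ 0) :
    |∑ d ∈ Finset.Ioc 0 n, (ArithmeticFunction.moebius d : ℝ) / (d : ℝ) ^ 2 - 6 / Real.pi ^ 2| ≤
      (n : ℝ)⁻¹ := by
  have hlim := hasSum_moebius_div_sq.tendsto_sum_nat.comp (Filter.tendsto_add_atTop_nat 1)
  have hIoc : ∀ N, ∑ d ∈ Finset.range (N + 1), (ArithmeticFunction.moebius d : ℝ) / (d : ℝ) ^ 2 =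
      ∑ d ∈ Finset.Ioc 0 N, (ArithmeticFunction.moebius d : ℝ) / (d : ℝ) ^ 2 := by
    intro N
    refine (Finset.sum_subset (fun d hd => ?_) fun d hd hd' => ?_).symm
    · simp only [Finset.mem_Ioc, Finset.mem_range] at hd ⊢
      lia
    · have : d = 0 := by
        simp only [Finset.mem_Ioc, Finset.mem_range] at hd hd'
        lia
      simp [this]
  rw [abs_sub_comm]
  refine le_of_tendsto (hlim.sub_const _).abs ?_
  filter_upwards [Filter.eventually_ge_atTop n] with N hN
  simp only [Function.comp_apply]
  rw [hIoc, ← Finset.sum_Ioc_consecutive _ n.zero_le hN, add_sub_cancel_left]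
  calc _ ≤ ∑ d ∈ Finset.Ioc n N, ((d : ℝ) ^ 2)⁻¹ := by
        refine (Finset.abs_sum_le_sum_abs _ _).trans (Finset.sum_le_sum fun d _ => ?_)
        rw [abs_div, abs_of_nonneg (sq_nonneg (d : ℝ)), inv_eq_one_div]
        gcongr
        exact_mod_cast ArithmeticFunction.abs_moebius_le_one
    _ ≤ _ := sum_Ioc_inv_sq_le_sub hn hN
    _ ≤ _ := sub_le_self _ (by positivity)

lemma sum_Ioc_inv_le (n : ℕ) : ∑ d ∈ Finset.Ioc 0 n, (d : ℝ)⁻¹ ≤ 1 + Real.log n := by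
  refine Eq.trans_le ?_ (harmonic_le_one_add_log n)
  rw [harmonic_eq_sum_Icc]
  push_cast
  rfl

lemma sum_Ioc_filter_dvd_inv_sq_le {p : ℕ} (hp : 0 < p) (n : ℕ) :
    ∑ d ∈ Finset.Ioc 0 n with p ∣ d, ((d : ℝ) ^ 2)⁻¹ ≤ 2 / p ^ 2 := by
  have hinj : Set.InjOn (p * ·) (Finset.Ioc 0 n : Set ℕ) := fun a _ b _ h =>
    Nat.eq_of_mul_eq_mul_left hp h
  calc _ ≤ ∑ d ∈ (Finset.Ioc 0 n).image (p * ·), ((d : ℝ) ^ 2)⁻¹ := by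
        refine Finset.sum_le_sum_of_subset_of_nonneg ?_ fun _ _ _ => by positivity
        intro d hd
        simp only [Finset.mem_filter, Finset.mem_Ioc, Finset.mem_image] at hd ⊢
        obtain ⟨⟨hd0, hdn⟩, e, rfl⟩ := hd
        exact ⟨e, ⟨Nat.pos_of_mul_pos_left hd0, by nlinarith⟩, rfl⟩
    _ = (∑ e ∈ Finset.Ioc 0 n, ((e : ℝ) ^ 2)⁻¹) / p ^ 2 := by
        rw [Finset.sum_image hinj, Finset.sum_div]
        refine Finset.sum_congr rfl fun e _ => ?_
        push_cast
        rw [mul_pow, mul_inv, mul_comm, div_eq_mul_inv]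
    _ ≤ _ := by gcongr; exact sum_Ioc_inv_sq_le_two n

lemma sum_divisors_moebius {g : ℕ} :
    ∑ d ∈ g.divisors, (ArithmeticFunction.moebius d : ℝ) = if g = 1 then 1 else 0 := by
  have h := congrArg (fun f : ArithmeticFunction ℤ => f g) ArithmeticFunction.moebius_mul_coe_zeta
  simp only [ArithmeticFunction.coe_mul_zeta_apply, ArithmeticFunction.one_apply] at h
  exact_mod_cast h

/-- The number of pairs `(a, b)` of multiples of `d` in `[1, n]` with `a = v * b` in `ℤ/pℤ`. -/
noncomputable def multipleCount (p n : ℕ) (v : ZMod p) (d : ℕ) : ℕ :=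
  ((Finset.Icc 1 n ×ˢ Finset.Icc 1 n).filter fun z : ℕ × ℕ =>
    (z.1 : ZMod p) = v * (z.2 : ZMod p) ∧ d ∣ z.1 ∧ d ∣ z.2).card

lemma RTp_eq_sum_moebius_mul (T : ℝ) (p : ℕ) [Fact p.Prime] (v : ℤ) :
    (RTp T p v : ℝ) = ∑ d ∈ Finset.Ioc 0 ⌊T⌋₊,
      (ArithmeticFunction.moebius d : ℝ) * multipleCount p ⌊T⌋₊ v d := by
  have hp : p.Prime := Fact.out
  set n := ⌊T⌋₊
  set S := (Finset.Icc 1 n ×ˢ Finset.Icc 1 n).filter fun z : ℕ × ℕ =>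
    (z.1 : ZMod p) = (v : ZMod p) * (z.2 : ZMod p) with hS
  have hR : RTp T p v = (S.filter fun z => Nat.gcd z.1 z.2 = 1).card := by
    rw [RTp, hS, Finset.filter_filter]
    congr 1
    refine Finset.filter_congr fun z _ => ⟨fun h => ⟨h.2.2, h.1⟩, fun h => ⟨h.2, ?_, h.1⟩⟩
    rw [Nat.coprime_comm, Nat.Prime.coprime_iff_not_dvd hp]
    intro h2
    have h1 : p ∣ z.1 := by
      rw [← ZMod.natCast_eq_zero_iff] at h2 ⊢
      rw [h.1, h2, mul_zero]
    exact hp.one_lt.ne' (Nat.dvd_one.1 (h.2 ▸ Nat.dvd_gcd h1 h2))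
  have hG : ∀ d, (multipleCount p n v d : ℝ) = ∑ z ∈ S, if d ∣ z.1 ∧ d ∣ z.2 then 1 else 0 := by
    intro d
    rw [Finset.sum_boole, hS, Finset.filter_filter, multipleCount]
  rw [hR, ← Finset.sum_boole]
  simp only [hG, Finset.mul_sum]
  rw [Finset.sum_comm]
  refine Finset.sum_congr rfl fun z hz => ?_
  rw [← sum_divisors_moebius]
  simp only [mul_ite, mul_one, mul_zero]
  rw [← Finset.sum_filter]
  refine Finset.sum_congr ?_ fun _ _ => rfl
  ext d
  simp only [hS, Finset.mem_filter, Finset.mem_product, Finset.mem_Icc] at hz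
  simp only [Nat.mem_divisors, Finset.mem_filter, Finset.mem_Ioc, Nat.dvd_gcd_iff]
  constructor
  · rintro ⟨⟨h1, h2⟩, -⟩
    exact ⟨⟨Nat.pos_of_dvd_of_pos h1 (by lia), (Nat.le_of_dvd (by lia) h1).trans hz.1.1.2⟩, h1, h2⟩
  · rintro ⟨-, h⟩
    exact ⟨h, fun h0 => by have := (Nat.gcd_eq_zero_iff.1 h0).1; lia⟩

lemma multipleCount_le (p n : ℕ) (v : ZMod p) {d : ℕ} (hd : 0 < d) :
    multipleCount p n v d ≤ (n / d) ^ 2 := by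
  have h : (Finset.Icc 1 (n / d) ×ˢ Finset.Icc 1 (n / d)).card = (n / d) ^ 2 := by simp [sq]
  rw [← h, multipleCount]
  refine Finset.card_le_card_of_surjOn (fun z => (d * z.1, d * z.2)) ?_
  rintro ⟨a, b⟩ hz
  simp only [Finset.coe_filter, Finset.mem_product, Finset.mem_Icc, Set.mem_ofPred_eq] at hz
  obtain ⟨⟨⟨ha, ha'⟩, hb, hb'⟩, -, ⟨a', rfl⟩, b', rfl⟩ := hz
  refine ⟨(a', b'), ?_, rfl⟩
  simp only [Finset.coe_product, Set.mem_prod, Finset.mem_coe, Finset.mem_Icc,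
    Nat.le_div_iff_mul_le hd]
  exact ⟨⟨Nat.pos_of_mul_pos_left ha, by linarith⟩, Nat.pos_of_mul_pos_left hb, by linarith⟩

lemma multipleCount_eq_boxCount {p d : ℕ} [Fact p.Prime] (n : ℕ) (v : ZMod p) (hd : ¬ p ∣ d) :
    multipleCount p n v d = boxCount p v 1 (n / d : ℕ) 0 := by
  have hd0 : 0 < d := Nat.pos_of_ne_zero fun h => hd (h ▸ dvd_zero p)
  have hdp : (d : ZMod p) ≠ 0 := by rwa [Ne, ZMod.natCast_eq_zero_iff]
  rw [multipleCount, boxCount]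
  refine (Finset.card_bij (fun z _ => (d * z.1.toNat, d * z.2.toNat)) ?_ ?_ ?_).symm
  · rintro ⟨a, b⟩ hz
    simp only [Finset.mem_filter, Finset.mem_product, Finset.mem_Icc] at hz ⊢
    obtain ⟨⟨⟨ha, ha'⟩, hb, hb'⟩, hab⟩ := hz
    lift a to ℕ using by lia
    lift b to ℕ using by lia
    norm_cast at ha ha' hb hb'
    rw [Nat.le_div_iff_mul_le hd0] at ha' hb'
    simp only [Int.toNat_natCast, dvd_mul_right, and_self, and_true]
    refine ⟨⟨⟨Nat.mul_pos hd0 ha, by linarith⟩, Nat.mul_pos hd0 hb, by linarith⟩, ?_⟩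
    push_cast at hab ⊢
    rw [sub_eq_zero.1 hab]
    ring
  · rintro ⟨a, b⟩ hz ⟨a', b'⟩ hz' h
    simp only [Finset.mem_filter, Finset.mem_product, Finset.mem_Icc] at hz hz'
    simp only [Prod.mk.injEq] at h ⊢
    have h1 := Nat.eq_of_mul_eq_mul_left hd0 h.1
    have h2 := Nat.eq_of_mul_eq_mul_left hd0 h.2
    lia
  · rintro ⟨a, b⟩ hz
    simp only [Finset.mem_filter, Finset.mem_product, Finset.mem_Icc] at hz
    obtain ⟨⟨⟨ha, ha'⟩, hb, hb'⟩, hab, ⟨a', rfl⟩, b', rfl⟩ := hz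
    refine ⟨((a' : ℤ), (b' : ℤ)), ?_, by simp⟩
    have ha0 : 0 < a' := Nat.pos_of_mul_pos_left ha
    have hb0 : 0 < b' := Nat.pos_of_mul_pos_left hb
    have han : a' ≤ n / d := by rw [Nat.le_div_iff_mul_le hd0]; linarith
    have hbn : b' ≤ n / d := by rw [Nat.le_div_iff_mul_le hd0]; linarith
    simp only [Finset.mem_filter, Finset.mem_product, Finset.mem_Icc]
    refine ⟨⟨⟨by exact_mod_cast ha0, by exact_mod_cast han⟩, by exact_mod_cast hb0,
      by exact_mod_cast hbn⟩, ?_⟩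
    rw [sub_eq_zero]
    refine mul_left_cancel₀ hdp ?_
    push_cast at hab ⊢
    rw [hab]
    ring

lemma sum_abs_multipleCount_sub_le_of_not_dvd {p d : ℕ} [Fact p.Prime] (n : ℕ) (hd : ¬ p ∣ d) :
    ∑ v : ZMod p, |(multipleCount p n v d : ℝ) - (n / d) ^ 2 / p| ≤
      50 * (n / d) * √p * (2 + Real.log p) ^ 2 := by
  have hd0 : 0 < d := Nat.pos_of_ne_zero fun h => hd (h ▸ dvd_zero p)
  have hp : (0 : ℝ) < p := by exact_mod_cast (Fact.out : p.Prime).pos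
  have hp1 : (1 : ℝ) ≤ p := by exact_mod_cast (Fact.out : p.Prime).one_le
  have hlog : 0 ≤ Real.log p := Real.log_natCast_nonneg p
  have hs1 : 1 ≤ √(p : ℝ) := Real.one_le_sqrt.2 hp1
  obtain ⟨k, hk⟩ : ∃ k, k = n / d := ⟨_, rfl⟩
  have hkx : (k : ℝ) ≤ n / d := hk ▸ Nat.cast_div_le
  have hxk : (n : ℝ) / d < k + 1 := by
    rw [div_lt_iff₀ (by positivity), hk]
    have := Nat.lt_div_mul_add (a := n) hd0
    calc (n : ℝ) < (n / d * d + d : ℕ) := by exact_mod_cast this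
      _ = _ := by push_cast; ring
  have hk0 : (0 : ℝ) ≤ k := k.cast_nonneg
  set x : ℝ := n / d
  have hx0 : 0 ≤ x := hk0.trans hkx
  have hsq : |(k : ℝ) ^ 2 / p - x ^ 2 / p| ≤ 2 * x / p := by
    rw [← sub_div, abs_div, abs_of_pos hp]
    gcongr
    rw [abs_le]
    constructor <;> nlinarith
  calc _ ≤ ∑ v : ZMod p, (|(boxCount p v 1 k 0 : ℝ) - (k : ℝ) ^ 2 / p| + 2 * x / p) := by
        refine Finset.sum_le_sum fun v _ => ?_
        rw [multipleCount_eq_boxCount n v hd, ← hk]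
        exact (abs_sub_le _ ((k : ℝ) ^ 2 / p) _).trans (by gcongr)
    _ = ∑ v : ZMod p, |(boxCount p v 1 k 0 : ℝ) - (k : ℝ) ^ 2 / p| + 2 * x * 1 * 1 := by
        rw [Finset.sum_add_distrib, Finset.sum_const, Finset.card_univ, ZMod.card, nsmul_eq_mul,
          mul_div_cancel₀ _ hp.ne']
        ring
    _ ≤ 48 * k * √p * (2 + Real.log p) ^ 2 + 2 * x * √p * (2 + Real.log p) ^ 2 := by
        gcongr
        · exact sum_abs_boxCount_sub_le p k
        · nlinarith
    _ ≤ 48 * x * √p * (2 + Real.log p) ^ 2 + 2 * x * √p * (2 + Real.log p) ^ 2 := by gcongr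
    _ = _ := by ring

lemma sum_abs_multipleCount_sub_le {p d : ℕ} [Fact p.Prime] (n : ℕ) (hd : 0 < d) :
    ∑ v : ZMod p, |(multipleCount p n v d : ℝ) - (n / d) ^ 2 / p| ≤ p * (n / d) ^ 2 := by
  have hp1 : (1 : ℝ) ≤ p := by exact_mod_cast (Fact.out : p.Prime).one_le
  calc _ ≤ ∑ _v : ZMod p, ((n : ℝ) / d) ^ 2 := by
        refine Finset.sum_le_sum fun v _ => ?_
        refine abs_sub_le_of_nonneg_of_le (by positivity) ?_ (by positivity)
          (div_le_self (by positivity) hp1)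
        calc (multipleCount p n v d : ℝ) ≤ ((n / d : ℕ) : ℝ) ^ 2 := by
              exact_mod_cast multipleCount_le p n v hd
          _ ≤ _ := by gcongr; exact Nat.cast_div_le
    _ = _ := by simp [ZMod.card]

lemma sum_sum_abs_multipleCount_sub_le (p n : ℕ) [Fact p.Prime] :
    ∑ d ∈ Finset.Ioc 0 n, ∑ v : ZMod p, |(multipleCount p n v d : ℝ) - (n / d) ^ 2 / p| ≤
      50 * n * √p * (2 + Real.log p) ^ 2 * (1 + Real.log n) + 2 * n ^ 2 / p := by
  have hp0 : 0 < p := (Fact.out : p.Prime).pos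
  have hp : (0 : ℝ) < p := by exact_mod_cast hp0
  have hlog : 0 ≤ Real.log p := Real.log_natCast_nonneg p
  rw [← Finset.sum_filter_add_sum_filter_not _ (p ∣ ·), add_comm]
  refine add_le_add ?_ ?_
  · calc _ ≤ ∑ d ∈ Finset.Ioc 0 n with ¬ p ∣ d, 50 * n * √p * (2 + Real.log p) ^ 2 * (d : ℝ)⁻¹ :=
          Finset.sum_le_sum fun d hd =>
            (sum_abs_multipleCount_sub_le_of_not_dvd n (Finset.mem_filter.1 hd).2).trans_eq
              (by ring)
      _ ≤ ∑ d ∈ Finset.Ioc 0 n, 50 * n * √p * (2 + Real.log p) ^ 2 * (d : ℝ)⁻¹ :=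
          Finset.sum_le_sum_of_subset_of_nonneg (Finset.filter_subset _ _)
            fun _ _ _ => by positivity
      _ ≤ _ := by
          rw [← Finset.mul_sum]
          gcongr
          exact sum_Ioc_inv_le n
  · calc _ ≤ ∑ d ∈ Finset.Ioc 0 n with p ∣ d, p * n ^ 2 * ((d : ℝ) ^ 2)⁻¹ :=
          Finset.sum_le_sum fun d hd => (sum_abs_multipleCount_sub_le n
            (Finset.mem_Ioc.1 (Finset.mem_filter.1 hd).1).1).trans_eq (by ring)
      _ ≤ p * n ^ 2 * (2 / p ^ 2) := by
          rw [← Finset.mul_sum]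
          gcongr
          exact sum_Ioc_filter_dvd_inv_sq_le hp0 n
      _ = _ := by field_simp

lemma sum_abs_RTp_sub_le (p : ℕ) [Fact p.Prime] {T : ℝ} (hT : 1 ≤ T) :
    ∑ v ∈ Finset.Icc 1 (p - 1), |((RTp T p (v : ℤ)) : ℝ) - 6 / Real.pi ^ 2 * T ^ 2 / p| ≤
      50 * T * √p * (2 + Real.log p) ^ 2 * (1 + Real.log T) + 2 * T ^ 2 / p + 3 * T := by
  have hp : (0 : ℝ) < p := by exact_mod_cast (Fact.out : p.Prime).pos
  have hlog : 0 ≤ Real.log p := Real.log_natCast_nonneg p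
  obtain ⟨n, hn⟩ : ∃ n, n = ⌊T⌋₊ := ⟨_, rfl⟩
  have hn0 : n ≠ 0 := by rw [hn, Ne, Nat.floor_eq_zero]; linarith
  have hn0' : (0 : ℝ) < n := by positivity
  have hnT : (n : ℝ) ≤ T := hn ▸ Nat.floor_le (by linarith)
  have hTn : T < n + 1 := hn ▸ Nat.lt_floor_add_one T
  set c : ℝ := 6 / Real.pi ^ 2
  have hc0 : 0 ≤ c := by positivity
  have hc1 : c ≤ 1 := by
    rw [div_le_one (by positivity)]
    nlinarith [Real.pi_gt_three]
  set E : ZMod p → ℕ → ℝ := fun v d => (multipleCount p n v d : ℝ) - (n / d) ^ 2 / p with hE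
  set m : ℝ := ∑ d ∈ Finset.Ioc 0 n, (ArithmeticFunction.moebius d : ℝ) / (d : ℝ) ^ 2 with hm
  have key : ∀ v : ℕ, |((RTp T p (v : ℤ)) : ℝ) - c * T ^ 2 / p| ≤
      ∑ d ∈ Finset.Ioc 0 n, |E v d| + (n + 2 * T) / p := by
    intro v
    have h1 : (RTp T p (v : ℤ) : ℝ) =
        ∑ d ∈ Finset.Ioc 0 n, (ArithmeticFunction.moebius d : ℝ) * E v d + n ^ 2 / p * m := by
      rw [RTp_eq_sum_moebius_mul, ← hn, hm, Finset.mul_sum, ← Finset.sum_add_distrib]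
      refine Finset.sum_congr rfl fun d _ => ?_
      simp only [hE, Int.cast_natCast]
      ring
    have h2 : |∑ d ∈ Finset.Ioc 0 n, (ArithmeticFunction.moebius d : ℝ) * E v d| ≤
        ∑ d ∈ Finset.Ioc 0 n, |E v d| := by
      refine (Finset.abs_sum_le_sum_abs _ _).trans (Finset.sum_le_sum fun d _ => ?_)
      rw [abs_mul]
      refine mul_le_of_le_one_left (abs_nonneg _) ?_
      exact_mod_cast ArithmeticFunction.abs_moebius_le_one
    have h3 : |(n : ℝ) ^ 2 / p * (m - c)| ≤ n / p := by
      rw [abs_mul, abs_of_nonneg (by positivity)]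
      calc _ ≤ (n : ℝ) ^ 2 / p * (n : ℝ)⁻¹ := by
            gcongr
            exact abs_sum_moebius_div_sq_sub_le hn0
        _ = _ := by field_simp
    have h4 : |c * (n ^ 2 - T ^ 2) / p| ≤ 2 * T / p := by
      rw [abs_div, abs_of_pos hp, abs_mul, abs_of_nonneg hc0]
      refine div_le_div_of_nonneg_right ((mul_le_of_le_one_left (abs_nonneg _) hc1).trans ?_) hp.le
      rw [abs_le]
      constructor <;> nlinarith
    have h5 : (RTp T p (v : ℤ) : ℝ) - c * T ^ 2 / p =
        ∑ d ∈ Finset.Ioc 0 n, (ArithmeticFunction.moebius d : ℝ) * E v d +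
          (n : ℝ) ^ 2 / p * (m - c) + c * (n ^ 2 - T ^ 2) / p := by
      rw [h1]
      ring
    rw [h5, add_div, ← add_assoc]
    exact (abs_add_three _ _ _).trans (by gcongr)
  set F : ZMod p → ℝ := fun v => ∑ d ∈ Finset.Ioc 0 n, |E v d| + (n + 2 * T) / p with hF
  have hinj : Set.InjOn (fun v : ℕ => (v : ZMod p)) (Finset.Icc 1 (p - 1) : Set ℕ) := by
    intro a ha b hb h
    simp only [Finset.coe_Icc, Set.mem_Icc] at ha hb
    have := (ZMod.natCast_eq_natCast_iff' a b p).1 h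
    rwa [Nat.mod_eq_of_lt (by lia), Nat.mod_eq_of_lt (by lia)] at this
  calc _ ≤ ∑ v ∈ Finset.Icc 1 (p - 1), F v := Finset.sum_le_sum fun v _ => key v
    _ = ∑ v ∈ (Finset.Icc 1 (p - 1)).image (fun v : ℕ => (v : ZMod p)), F v := by
        rw [Finset.sum_image hinj]
    _ ≤ ∑ v : ZMod p, F v :=
        Finset.sum_le_sum_of_subset_of_nonneg (Finset.subset_univ _) fun v _ _ =>
          add_nonneg (Finset.sum_nonneg fun _ _ => abs_nonneg _) (by positivity)
    _ = ∑ d ∈ Finset.Ioc 0 n, ∑ v : ZMod p, |E v d| + (n + 2 * T) := by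
        rw [Finset.sum_add_distrib, Finset.sum_comm, Finset.sum_const, Finset.card_univ,
          ZMod.card, nsmul_eq_mul, mul_div_cancel₀ _ hp.ne']
    _ ≤ (50 * n * √p * (2 + Real.log p) ^ 2 * (1 + Real.log n) + 2 * n ^ 2 / p) +
          (n + 2 * T) := by
        gcongr
        exact sum_sum_abs_multipleCount_sub_le p n
    _ ≤ (50 * T * √p * (2 + Real.log p) ^ 2 * (1 + Real.log T) + 2 * T ^ 2 / p) +
          (T + 2 * T) := by
        have := Real.log_natCast_nonneg n
        gcongr
    _ = _ := by ring

lemma exists_two_add_log_pow_three_le {δ : ℝ} (hδ : 0 < δ) :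
    ∃ C : ℝ, 0 < C ∧ ∀ x : ℝ, 1 ≤ x → (2 + Real.log x) ^ 3 ≤ C * x ^ δ := by
  refine ⟨(2 + 3 / δ) ^ 3, by positivity, fun x hx => ?_⟩
  have hx0 : 0 ≤ x := by linarith
  have h1 : Real.log x ≤ x ^ (δ / 3) / (δ / 3) := Real.log_le_rpow_div hx0 (by positivity)
  have h2 : 1 ≤ x ^ (δ / 3) := Real.one_le_rpow hx (by positivity)
  have h0 := Real.log_nonneg hx
  calc (2 + Real.log x) ^ 3 ≤ ((2 + 3 / δ) * x ^ (δ / 3)) ^ 3 := by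
        gcongr
        calc _ ≤ 2 * x ^ (δ / 3) + x ^ (δ / 3) / (δ / 3) := by linarith
          _ = _ := by field_simp
    _ = (2 + 3 / δ) ^ 3 * x ^ δ := by
        rw [mul_pow, ← Real.rpow_mul_natCast hx0]
        congr 2
        push_cast
        ring

lemma exists_sqrt_mul_log_le {ε : ℝ} (hε : 0 < ε) :
    ∃ C : ℝ, 0 < C ∧ ∀ x T : ℝ, 1 ≤ x → 1 ≤ T →
      √x * (2 + Real.log x) ^ 2 * (1 + Real.log T) ≤ C * (T / x + x ^ ((1 : ℝ) / 2 + ε)) := by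
  obtain ⟨A, hA, hAx⟩ := exists_two_add_log_pow_three_le hε
  obtain ⟨B, hB, hBT⟩ := exists_two_add_log_pow_three_le (δ := 1 / 2) (by norm_num)
  refine ⟨4 * A + B, by positivity, fun x T hx hT => ?_⟩
  have hx0 : 0 < x := by linarith
  have hT0 : 0 < T := by linarith
  have hlx := Real.log_nonneg hx
  have hlT := Real.log_nonneg hT
  have hpow : 0 < x ^ ((1 : ℝ) / 2 + ε) := by positivity
  have hdiv : 0 < T / x := by positivity
  rcases le_total T (x ^ 4) with h | h
  · have hl : Real.log T ≤ 4 * Real.log x := by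
      have := Real.log_le_log hT0 h
      rwa [Real.log_pow] at this
    calc _ ≤ √x * (2 + Real.log x) ^ 2 * (4 * (2 + Real.log x)) := by
          gcongr
          linarith
      _ = 4 * √x * (2 + Real.log x) ^ 3 := by ring
      _ ≤ 4 * √x * (A * x ^ ε) := by
          gcongr
          exact hAx x hx
      _ = 4 * A * x ^ ((1 : ℝ) / 2 + ε) := by
          rw [Real.rpow_add hx0, ← Real.sqrt_eq_rpow]
          ring
      _ ≤ _ := by nlinarith [mul_pos hA hdiv, mul_pos hB hdiv, mul_pos hB hpow]
  · have hxT : x ≤ T := (le_self_pow₀ hx (by norm_num)).trans h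
    have hlog : Real.log x ≤ Real.log T := Real.log_le_log hx0 hxT
    have hsx : √x ≤ x := Real.sqrt_le_iff.2 ⟨hx0.le, by nlinarith⟩
    have hsT : x ^ 2 ≤ √T := Real.le_sqrt_of_sq_le (by rw [← pow_mul]; exact h)
    calc _ ≤ x * (2 + Real.log T) ^ 2 * (2 + Real.log T) := by
          gcongr
          norm_num
      _ = x * (2 + Real.log T) ^ 3 := by ring
      _ ≤ x * (B * √T) := by
          gcongr
          rw [Real.sqrt_eq_rpow]
          exact hBT T hT
      _ = B * (x ^ 2 * √T / x) := by field_simp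
      _ ≤ B * (√T * √T / x) := by gcongr
      _ = B * (T / x) := by rw [Real.mul_self_sqrt hT0.le]
      _ ≤ _ := by nlinarith [mul_pos hA hdiv, mul_pos hB hpow, mul_pos hA hpow]

/-- For every `ε > 0` there is `C > 0` such that for all primes `p` and all real
`T ≥ 1`, `Σ_{v=1}^{p-1} |R_{T,p}(v) − (6/π²)·T²/p| ≤ C·(T²·p⁻¹ + T·p^{1/2+ε})`. -/
theorem sum_RTp_deviation_bound (ε : ℝ) (hε : 0 < ε) :
    ∃ C : ℝ, 0 < C ∧ ∀ p : ℕ, p.Prime → ∀ T : ℝ, 1 ≤ T →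
      ∑ v ∈ Finset.Icc 1 (p - 1),
          |((RTp T p (v : ℤ)) : ℝ) - 6 / Real.pi ^ 2 * T ^ 2 / p| ≤
        C * (T ^ 2 / p + T * (p : ℝ) ^ ((1 : ℝ) / 2 + ε)) := by
  obtain ⟨C, hC, hCx⟩ := exists_sqrt_mul_log_le hε
  refine ⟨50 * C + 5, by positivity, fun p hp T hT => ?_⟩
  have : Fact p.Prime := ⟨hp⟩
  have hp1 : (1 : ℝ) ≤ p := by exact_mod_cast hp.one_le
  have hT0 : 0 < T := by linarith
  have hpow : 1 ≤ (p : ℝ) ^ ((1 : ℝ) / 2 + ε) := Real.one_le_rpow hp1 (by positivity)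
  have hdiv : 0 ≤ T ^ 2 / p := by positivity
  calc _ ≤ 50 * T * √p * (2 + Real.log p) ^ 2 * (1 + Real.log T) + 2 * T ^ 2 / p + 3 * T :=
        sum_abs_RTp_sub_le p hT
    _ = 50 * T * (√p * (2 + Real.log p) ^ 2 * (1 + Real.log T)) + 2 * (T ^ 2 / p) +
          3 * T * 1 := by ring
    _ ≤ 50 * T * (C * (T / p + (p : ℝ) ^ ((1 : ℝ) / 2 + ε))) + 5 * (T ^ 2 / p) +
          5 * T * (p : ℝ) ^ ((1 : ℝ) / 2 + ε) := by
        refine add_le_add (add_le_add ?_ ?_) ?_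
        · exact mul_le_mul_of_nonneg_left (hCx p T hp1 hT) (by positivity)
        · linarith
        · gcongr
          norm_num
    _ = _ := by ring
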